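/- Let C be the set of cubic forms f ∈ ℂ[x₀,…,x₅] that can be written as f = Σᵢ₌₁¹⁰ (aᵢ·x)³ for vectors a₁,…,a₁₀ ∈ ℂ⁶ such that four of them are coplanar, i.e., dim span{a₁,a₂,a₃,a₄} ≤ 3. Then the vanishing ideal of C (in the polynomial ring on the 56 coefficients of a cubic form in 6 variables) is a prime ideal of height 1; equivalently, the Zariski closure of C is an irreducible hypersurface in the 56-dimensional space of cubic forms. (Lemma 2.3 of the paper: the divisor D_{copl} is an irreducible divisor.) -/

import Mathlib

open MvPolynomial

/-- The constant-coefficient differential operator associated with the monomial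
exponent `d`: the composition over `i` of `(∂/∂xᵢ)^(d i)`. -/
noncomputable def monOp {n : ℕ} (d : Fin n →₀ ℕ) :
    Module.End ℂ (MvPolynomial (Fin n) ℂ) :=
  (List.ofFn fun i : Fin n =>
    ((pderiv (R := ℂ) i).toLinearMap : Module.End ℂ (MvPolynomial (Fin n) ℂ)) ^ (d i)).prod

/-- The apolarity action `g ∘ f` : apply `g`, viewed as a constant-coefficient
differential operator, to `f`. -/
noncomputable def apolar {n : ℕ} (g f : MvPolynomial (Fin n) ℂ) :
    MvPolynomial (Fin n) ℂ :=
  ∑ d ∈ g.support, coeff d g • monOp d f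

/-- The apolarity pairing `⟨f, k⟩ := k ∘ f` (its constant term). -/
noncomputable def pairing {n : ℕ} (f k : MvPolynomial (Fin n) ℂ) : ℂ :=
  eval (fun _ => (0 : ℂ)) (apolar k f)

/-- The linear form `Σ vᵢ xᵢ` associated with a vector `v`. -/
noncomputable def linForm {n : ℕ} (v : Fin n → ℂ) : MvPolynomial (Fin n) ℂ :=
  ∑ i, MvPolynomial.C (v i) * X i

/-- The directional partial derivative `∂_v f = Σ vᵢ ∂f/∂xᵢ`. -/
noncomputable def pdir {n : ℕ} (v : Fin n → ℂ) (f : MvPolynomial (Fin n) ℂ) :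
    MvPolynomial (Fin n) ℂ :=
  ∑ i, MvPolynomial.C (v i) * pderiv i f

/-- The Veronese map `ν : ℂ³ → ℂ⁶`. -/
noncomputable def nu (w : Fin 3 → ℂ) : Fin 6 → ℂ :=
  ![w 0 ^ 2, 2 * w 0 * w 1, 2 * w 0 * w 2, w 1 ^ 2, 2 * w 1 * w 2, w 2 ^ 2]

/-- The components of the Veronese map as quadratic forms in `y₀, y₁, y₂`. -/
noncomputable def nuPoly : Fin 6 → MvPolynomial (Fin 3) ℂ :=
  ![X 0 ^ 2, 2 * X 0 * X 1, 2 * X 0 * X 2, X 1 ^ 2, 2 * X 1 * X 2, X 2 ^ 2]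

/-- A quadratic form `q` in 6 variables has rank `≤ r`: there is a symmetric matrix
`M` of rank `≤ r` with `q(x) = xᵀ M x`. -/
def QuadRankLe (q : MvPolynomial (Fin 6) ℂ) (r : ℕ) : Prop :=
  ∃ M : Matrix (Fin 6) (Fin 6) ℂ, M.IsSymm ∧ M.rank ≤ r ∧
    ∀ x : Fin 6 → ℂ, eval x q = ∑ i, ∑ j, M i j * x i * x j

/-- `s` is the linear map carrying a ternary sextic `g` to the cubic `s(g)` in six
variables, characterized by `⟨s(g), k⟩ = ⟨g, m(k)⟩` for all cubic forms `k`, where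
`m(k) = k ∘ ν`. -/
def IsSMap (s : MvPolynomial (Fin 3) ℂ →ₗ[ℂ] MvPolynomial (Fin 6) ℂ) : Prop :=
  (∀ g : MvPolynomial (Fin 3) ℂ, g.IsHomogeneous 6 → (s g).IsHomogeneous 3) ∧
  ∀ g : MvPolynomial (Fin 3) ℂ, ∀ k : MvPolynomial (Fin 6) ℂ,
    g.IsHomogeneous 6 → k.IsHomogeneous 3 →
      pairing (s g) k = pairing g (aeval nuPoly k)

/-- Evaluation of a polynomial function `P` in the coefficients at a polynomial `g`. -/
noncomputable def evalCoeff {σ : Type} (g : MvPolynomial σ ℂ) (P : MvPolynomial (σ →₀ ℕ) ℂ) : ℂ :=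
  eval (fun d => coeff d g) P

/-- The vanishing ideal of a subset of `ℂ⁵⁶`. -/
noncomputable def vanishingIdealOf (S : Set (Fin 56 → ℂ)) : Ideal (MvPolynomial (Fin 56) ℂ) :=
  ⨅ x ∈ S, RingHom.ker (eval x)

/-- An ideal is a prime ideal of height one: it is prime, admits a prime strictly
below it, and admits no chain of two primes strictly below it. -/
def IsHeightOnePrime {R : Type*} [CommRing R] (I : Ideal R) : Prop :=
  I.IsPrime ∧ (∃ p : Ideal R, p.IsPrime ∧ p < I) ∧
    ∀ p q : Ideal R, p.IsPrime → q.IsPrime → p < q → ¬ q < I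

/-- The space `Q_{f,U}` of quadratic forms vanishing on `U` and apolar to `f`. -/
def QfU (f : MvPolynomial (Fin 6) ℂ) (U : Submodule ℂ (Fin 6 → ℂ)) :
    Set (MvPolynomial (Fin 6) ℂ) :=
  {q | q.IsHomogeneous 2 ∧ (∀ u ∈ U, eval u q = 0) ∧ apolar q f = 0}

/-- The Zariski closure of a subset of `ℂ⁵⁶`. -/
def zcl (S : Set (Fin 56 → ℂ)) : Set (Fin 56 → ℂ) :=
  {x | ∀ P : MvPolynomial (Fin 56) ℂ, (∀ y ∈ S, eval y P = 0) → eval x P = 0}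

/-- The projection of a polynomial onto its squarefree monomials. -/
noncomputable def sqfreeProj (f : MvPolynomial (Fin 6) ℂ) : MvPolynomial (Fin 6) ℂ :=
  ∑ d ∈ f.support.filter (fun d => ∀ i, d i ≤ 1), monomial d (coeff d f)

/-- A nonzero element of the kernel of a homomorphism out of a domain extends every family
whose image is algebraically independent. -/
theorem AlgebraicIndependent.option_elim_of_map {k A B ι : Type*} [CommRing k] [CommRing A]
    [IsDomain A] [CommRing B] [Algebra k A] [Algebra k B] (f : A →ₐ[k] B) {a : ι → A}
    (h : AlgebraicIndependent k (f ∘ a)) {x : A} (hx : x ≠ 0) (hfx : f x = 0) :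
    AlgebraicIndependent k (fun o : Option ι => o.elim x a) := by
  have ha : AlgebraicIndependent k a := h.of_comp f
  rw [ha.option_iff_transcendental]
  have hinj : ∀ z ∈ Algebra.adjoin k (Set.range a), f z = 0 → z = 0 := by
    intro z hz hfz
    rw [Algebra.adjoin_range_eq_range_aeval] at hz
    obtain ⟨P, rfl⟩ := hz
    have hP : aeval (f ∘ a) P = 0 := by
      rw [← hfz]
      exact (MvPolynomial.comp_aeval_apply a f P).symm
    simp [h.eq_zero_of_aeval_eq_zero P hP]
  rintro ⟨p, hp0, hp⟩
  obtain ⟨q, hq, hndvd⟩ := p.exists_eq_pow_rootMultiplicity_mul_and_not_dvd hp0 0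
  simp only [map_zero, sub_zero] at hq hndvd
  rw [Polynomial.X_dvd_iff] at hndvd
  have hqx : Polynomial.aeval x q = 0 := by
    rw [hq] at hp
    simpa [hx] using hp
  apply hndvd
  have hdiv := congrArg (Polynomial.aeval x) (Polynomial.divX_mul_X_add q)
  simp only [map_add, map_mul, Polynomial.aeval_X, Polynomial.aeval_C, hqx] at hdiv
  have hf := congrArg f hdiv
  simp only [map_add, map_mul, hfx, mul_zero, zero_add, map_zero] at hf
  exact Subtype.ext (hinj _ (q.coeff 0).2 hf)

/-- The transcendence degree drops in a proper quotient of a domain. -/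
theorem Algebra.trdeg_add_one_le_of_surjective {k A B : Type} [Field k] [CommRing A]
    [IsDomain A] [CommRing B] [IsDomain B] [Algebra k A] [Algebra k B] (f : A →ₐ[k] B)
    (hf : Function.Surjective f) {x : A} (hx : x ≠ 0) (hfx : f x = 0) :
    Algebra.trdeg k B + 1 ≤ Algebra.trdeg k A := by
  obtain ⟨ι, b, hb⟩ := exists_isTranscendenceBasis' k B
  choose g hg using hf
  have h : AlgebraicIndependent k (f ∘ (g ∘ b)) := by
    convert hb.1 using 1
    ext i
    simp [hg]
  have := (h.option_elim_of_map f hx hfx).cardinalMk_le_trdeg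
  rwa [Cardinal.mk_option, hb.cardinalMk_eq_trdeg] at this

theorem mem_vanishingIdealOf {S : Set (Fin 56 → ℂ)} {P : MvPolynomial (Fin 56) ℂ} :
    P ∈ vanishingIdealOf S ↔ ∀ x ∈ S, eval x P = 0 := by
  simp [vanishingIdealOf, Submodule.mem_iInf, RingHom.mem_ker]

/-- If no nonzero polynomial vanishes on the union of the translates of `S` along one direction,
then the vanishing ideal of `S`, if prime, has height at most one. -/
theorem not_lt_vanishingIdealOf_of_lt {S : Set (Fin 56 → ℂ)} {m : Fin 56 → ℂ}
    (hS : ∀ P : MvPolynomial (Fin 56) ℂ, (∀ x ∈ S, ∀ s : ℂ, eval (x + s • m) P = 0) → P = 0)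
    (hI : (vanishingIdealOf S).IsPrime) {p q : Ideal (MvPolynomial (Fin 56) ℂ)}
    [hq : q.IsPrime] (hpq : p < q) : ¬ q < vanishingIdealOf S := by
  intro hqI
  set I := vanishingIdealOf S
  let R := MvPolynomial (Fin 56) ℂ
  have hR : Algebra.trdeg ℂ R = (56 : ℕ) := by
    rw [MvPolynomial.trdeg_of_isDomain]
    simp
  have hRq : Algebra.trdeg ℂ (R ⧸ q) + 1 ≤ Algebra.trdeg ℂ R := by
    obtain ⟨x, hxq, hxp⟩ := Set.exists_of_ssubset hpq
    refine Algebra.trdeg_add_one_le_of_surjective (Ideal.Quotient.mkₐ ℂ q)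
      (Ideal.Quotient.mkₐ_surjective ℂ q) (x := x) ?_ (Ideal.Quotient.eq_zero_iff_mem.mpr hxq)
    rintro rfl
    exact hxp p.zero_mem
  have hqI' : Algebra.trdeg ℂ (R ⧸ I) + 1 ≤ Algebra.trdeg ℂ (R ⧸ q) := by
    obtain ⟨x, hxI, hxq⟩ := Set.exists_of_ssubset hqI
    refine Algebra.trdeg_add_one_le_of_surjective (Ideal.Quotient.factorₐ ℂ hqI.le)
      (Ideal.Quotient.factor_surjective hqI.le) (x := Ideal.Quotient.mk q x) ?_ ?_
    · rwa [Ne, Ideal.Quotient.eq_zero_iff_mem]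
    · exact Ideal.Quotient.eq_zero_iff_mem.mpr hxI
  have hRI : Algebra.trdeg ℂ R ≤ Algebra.trdeg ℂ (R ⧸ I) + 1 := by
    rw [← Polynomial.trdeg_of_isDomain (R := R ⧸ I),
      trdeg_add_eq ℂ (R ⧸ I)]
    let φ : R →ₐ[ℂ] Polynomial (R ⧸ I) := aeval fun i =>
      Polynomial.C (Ideal.Quotient.mk I (X i)) + Polynomial.C (algebraMap ℂ _ (m i)) * Polynomial.X
    refine trdeg_le_of_injective φ ((injective_iff_map_eq_zero φ).mpr fun P hP => ?_)
    refine hS P fun x hx s => ?_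
    let ev : R ⧸ I →ₐ[ℂ] ℂ := Ideal.Quotient.liftₐ I (aeval x) fun Q hQ => by
      simpa [MvPolynomial.aeval_eq_eval] using mem_vanishingIdealOf.mp hQ x hx
    let ψ : Polynomial (R ⧸ I) →ₐ[ℂ] ℂ := (Polynomial.aeval s).comp (Polynomial.mapAlgHom ev)
    have hcomp : ψ.comp φ = aeval (x + s • m) := by
      ext i
      have hX : ev (Ideal.Quotient.mk I (X i)) = x i := aeval_X x i
      have hC : ev (algebraMap ℂ (R ⧸ I) (m i)) = m i := ev.commutes _
      have hφ : φ (X i) = Polynomial.C (Ideal.Quotient.mk I (X i)) +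
          Polynomial.C (algebraMap ℂ (R ⧸ I) (m i)) * Polynomial.X := aeval_X _ i
      rw [AlgHom.comp_apply, hφ, aeval_X]
      simp only [ψ, AlgHom.comp_apply, Polynomial.coe_mapAlgHom,
        Polynomial.map_C, Polynomial.map_X, map_add, map_mul,
        Polynomial.aeval_C, Polynomial.aeval_X, RingHom.coe_coe, hX, hC, Pi.add_apply,
        Pi.smul_apply, smul_eq_mul, mul_comm s, Algebra.algebraMap_self_apply]
    have := DFunLike.congr_fun hcomp P
    rw [AlgHom.comp_apply, hP, map_zero, MvPolynomial.aeval_eq_eval] at this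
    exact this.symm
  have hlt : Algebra.trdeg ℂ (R ⧸ I) < Cardinal.aleph0 := by
    refine lt_of_le_of_lt ?_ (Cardinal.natCast_lt_aleph0 (n := 56))
    rw [← hR]
    exact (le_self_add.trans hqI').trans (le_self_add.trans hRq)
  obtain ⟨n, hn⟩ := Cardinal.lt_aleph0.mp hlt
  have := (add_le_add_left hqI' 1).trans (hRq.trans hRI)
  rw [hn] at this
  norm_cast at this
  omega

/-- The parameters of a sum of ten cubes of linear forms four of which are coplanar: three vectors
spanning the plane, the coordinates of four vectors in it, and six further vectors. -/
abbrev CoplanarParam : Type :=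
  (Fin 3 → Fin 6 → ℂ) × (Fin 4 → Fin 3 → ℂ) × (Fin 6 → Fin 6 → ℂ)

/-- The sum of ten cubes of linear forms with given parameters. -/
noncomputable def coplanarCubic (p : CoplanarParam) : MvPolynomial (Fin 6) ℂ :=
  ∑ i, linForm (∑ j, p.2.1 i j • p.1 j) ^ 3 + ∑ k, linForm (p.2.2 k) ^ 3

theorem linForm_isHomogeneous {n : ℕ} (v : Fin n → ℂ) : (linForm v).IsHomogeneous 1 :=
  IsHomogeneous.sum _ _ _ fun i _ => by
    simpa using (isHomogeneous_C (Fin n) (v i)).mul (isHomogeneous_X ℂ i)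

theorem linForm_add {n : ℕ} (v w : Fin n → ℂ) : linForm (v + w) = linForm v + linForm w := by
  simp [linForm, add_mul, Finset.sum_add_distrib]

theorem linForm_smul {n : ℕ} (s : ℂ) (v : Fin n → ℂ) : linForm (s • v) = s • linForm v := by
  simp [linForm, Finset.smul_sum, smul_eq_C_mul, mul_assoc]

theorem linForm_sum {n : ℕ} {ι : Type*} (s : Finset ι) (v : ι → Fin n → ℂ) :
    linForm (∑ i ∈ s, v i) = ∑ i ∈ s, linForm (v i) := by
  simp only [linForm, Finset.sum_apply, map_sum, Finset.sum_mul]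
  exact Finset.sum_comm

theorem linForm_single {n : ℕ} (i : Fin n) : linForm (Pi.single i 1) = X i := by
  simp [linForm, Pi.single_apply, apply_ite C, ite_mul]

theorem coplanarCubic_isHomogeneous (p : CoplanarParam) : (coplanarCubic p).IsHomogeneous 3 :=
  (IsHomogeneous.sum _ _ _ fun _ _ => (linForm_isHomogeneous _).pow 3).add
    (IsHomogeneous.sum _ _ _ fun _ _ => (linForm_isHomogeneous _).pow 3)

/-- A submodule of dimension at most `n` is contained in the span of `n` vectors. -/
theorem Submodule.exists_le_span_range_of_finrank_le {K V : Type*} [Field K] [AddCommGroup V]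
    [Module K V] [FiniteDimensional K V] (W : Submodule K V) {n : ℕ}
    (h : Module.finrank K W ≤ n) : ∃ b : Fin n → V, W ≤ Submodule.span K (Set.range b) := by
  let B := Module.finBasis K W
  refine ⟨fun j => if hj : (j : ℕ) < Module.finrank K W then B ⟨j, hj⟩ else 0, fun w hw => ?_⟩
  have hw' := congrArg W.subtype (B.sum_repr ⟨w, hw⟩)
  rw [map_sum] at hw'
  change _ = w at hw'
  rw [← hw']
  refine Submodule.sum_mem _ fun i _ => ?_
  rw [map_smul]
  refine Submodule.smul_mem _ _ (Submodule.subset_span ⟨⟨i, i.2.trans_le h⟩, ?_⟩)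
  simp

theorem setOf_coplanar_eq_range :
    {f : MvPolynomial (Fin 6) ℂ | ∃ a : Fin 10 → (Fin 6 → ℂ), f = ∑ i, linForm (a i) ^ 3 ∧
      Module.finrank ℂ
        (Submodule.span ℂ ({a 0, a 1, a 2, a 3} : Set (Fin 6 → ℂ))) ≤ 3} =
      Set.range coplanarCubic := by
  ext f
  constructor
  · rintro ⟨a, rfl, ha⟩
    obtain ⟨b, hb⟩ := Submodule.exists_le_span_range_of_finrank_le _ ha
    have hmem : ∀ i : Fin 4, ∃ c : Fin 3 → ℂ, ∑ j, c j • b j = a (Fin.castAdd 6 i) := by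
      intro i
      refine (Submodule.mem_span_range_iff_exists_fun ℂ).mp (hb (Submodule.subset_span ?_))
      fin_cases i <;> simp [Fin.castAdd]
    choose c hc using hmem
    refine ⟨(b, c, fun k => a (Fin.natAdd 4 k)), ?_⟩
    simp only [coplanarCubic, hc]
    exact (Fin.sum_univ_add (a := 4) (b := 6) fun i => linForm (a i) ^ 3).symm
  · rintro ⟨⟨b, c, a⟩, rfl⟩
    refine ⟨Fin.append (fun i : Fin 4 => ∑ j, c i j • b j) a, ?_, ?_⟩
    · rw [coplanarCubic, Fin.sum_univ_add (a := 4) (b := 6)]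
      simp
    · have hle : Submodule.span ℂ (Set.range fun i : Fin 4 => ∑ j, c i j • b j) ≤
          Submodule.span ℂ (Set.range b) := by
        rw [Submodule.span_le]
        rintro _ ⟨i, rfl⟩
        exact Submodule.sum_mem _ fun j _ =>
          Submodule.smul_mem _ _ (Submodule.subset_span ⟨j, rfl⟩)
      refine (Submodule.finrank_mono (le_trans (Submodule.span_mono ?_) hle)).trans
        ((finrank_range_le_card b).trans (by simp))
      rintro _ (rfl | rfl | rfl | rfl)
      exacts [⟨0, rfl⟩, ⟨1, rfl⟩, ⟨2, rfl⟩, ⟨3, rfl⟩]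

theorem map_linForm_mul {M : Type*} [AddCommGroup M] [Module ℂ M] {n : ℕ}
    (E : MvPolynomial (Fin n) ℂ →ₗ[ℂ] M) (u v w : Fin n → ℂ) :
    E (linForm u * linForm v * linForm w) =
      ∑ i, ∑ j, ∑ k, (u i * v j * w k) • E (X i * X j * X k) := by
  rw [linForm, linForm, linForm, Finset.sum_mul_sum]
  simp_rw [Finset.sum_mul, map_sum]
  simp_rw [Finset.mul_sum, map_sum, ← map_smul]
  refine Finset.sum_congr rfl fun i _ => Finset.sum_congr rfl fun j _ =>
    Finset.sum_congr rfl fun k _ => congrArg E ?_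
  simp only [smul_eq_C_mul, C_mul]
  ring

theorem contDiff_coplanarCubic (E : MvPolynomial (Fin 6) ℂ →ₗ[ℂ] (Fin 56 → ℂ)) (n) :
    ContDiff ℂ n fun p => E (coplanarCubic p) := by
  simp only [coplanarCubic, map_add, map_sum, pow_three', map_linForm_mul]
  fun_prop

theorem isPrime_vanishingIdealOf_range (E : MvPolynomial (Fin 6) ℂ →ₗ[ℂ] (Fin 56 → ℂ)) :
    (vanishingIdealOf (Set.range fun p => E (coplanarCubic p))).IsPrime := by
  rw [Ideal.isPrime_iff]
  constructor
  · rw [Ideal.ne_top_iff_one, mem_vanishingIdealOf]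
    exact fun h => one_ne_zero ((map_one _).symm.trans (h _ ⟨0, rfl⟩))
  intro P Q hPQ
  simp only [mem_vanishingIdealOf, Set.forall_mem_range] at hPQ ⊢
  by_contra! h
  obtain ⟨⟨p, hp⟩, ⟨q, hq⟩⟩ := h
  let γ : ℂ → CoplanarParam := fun s => p + s • (q - p)
  have hγ : ContDiff ℂ ⊤ fun s => E (coplanarCubic (γ s)) :=
    (contDiff_coplanarCubic E ⊤).comp (by fun_prop)
  have han (P : MvPolynomial (Fin 56) ℂ) :
      AnalyticOnNhd ℂ (fun s => eval (E (coplanarCubic (γ s))) P) Set.univ := by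
    refine AnalyticOnNhd.aeval_mvPolynomial (fun i => ?_) P
    exact ((contDiff_pi.mp hγ) i).analyticOnNhd
  rcases (han P).eq_zero_or_eq_zero_of_mul_eq_zero (han Q)
    (fun s _ => by simpa using hPQ (γ s)) isPreconnected_univ with h | h
  · exact hp (by simpa [γ] using h 0 trivial)
  · exact hq (by simpa [γ] using h 1 trivial)

theorem Submodule.mem_of_natCast_mul_mem {A : Type*} [CommRing A] [Algebra ℂ A]
    (T : Submodule ℂ A) (n : ℕ) [NeZero n] {x : A} (h : (n : A) * x ∈ T) : x ∈ T := by
  have h' := T.smul_mem (n : ℂ)⁻¹ h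
  rwa [← nsmul_eq_mul, ← Nat.cast_smul_eq_nsmul ℂ, smul_smul,
    inv_mul_cancel₀ (NeZero.ne _), one_smul] at h'

/-- The coordinates of four vectors in a plane whose cubes add up to `24 y₀ y₁ y₂`. -/
def tetrahedron : Fin 4 → Fin 3 → ℂ := ![![1, 1, 1], ![-1, -1, 1], ![-1, 1, -1], ![1, -1, -1]]

section Spanning

variable {A : Type*} [CommRing A] [Algebra ℂ A] {T : Submodule ℂ A} {y z : Fin 3 → A}

theorem mul_mem_of_tetrahedron_sq_mul_mem
    (hT : ∀ i j, (∑ k, tetrahedron i k • y k) ^ 2 * y j ∈ T) (i j k : Fin 3) :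
    y i * y j * y k ∈ T := by
  have hne : ∀ i j k, i ≠ j → y i * y j * y k ∈ T := by
    intro i j k hij
    refine T.mem_of_natCast_mul_mem 8 ?_
    convert T.sum_mem fun l (_ : l ∈ Finset.univ) =>
      T.smul_mem (tetrahedron l i * tetrahedron l j) (hT l k) using 1
    fin_cases i <;> fin_cases j <;> simp [tetrahedron, Fin.sum_univ_succ] at hij ⊢ <;> ring
  by_cases hij : i = j
  · subst hij
    by_cases hik : i = k
    · subst hik
      refine T.mem_of_natCast_mul_mem 4 ?_
      have h1 : i + 1 ≠ i := by decide +revert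
      have h2 : i + 2 ≠ i := by decide +revert
      convert T.sub_mem (T.sum_mem fun l (_ : l ∈ Finset.univ) => hT l i)
        (T.smul_mem 4 (T.add_mem (hne _ _ (i + 1) h1) (hne _ _ (i + 2) h2))) using 1
      simp only [ofNat_smul_eq_nsmul, nsmul_eq_mul]
      fin_cases i <;> simp [tetrahedron, Fin.sum_univ_succ] <;> ring
    · rw [mul_right_comm]
      exact hne _ _ _ hik
  · exact hne _ _ _ hij

theorem mul_mul_mem_of_sum_tetrahedron_mem {u : A} {j : Fin 3}
    (h : ∑ i, tetrahedron i j • ((∑ k, tetrahedron i k • y k) ^ 2 * u) ∈ T) :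
    y (j + 1) * y (j + 2) * u ∈ T := by
  refine T.mem_of_natCast_mul_mem 8 ?_
  convert h using 1
  fin_cases j <;> simp [tetrahedron, Fin.sum_univ_succ] <;> ring

/-- Products of the `y i` and `z k` lie in `T` as soon as the multiples of the squares of the `z k`
and of the `y i + z (i + 1) + z (i + 2)` do, given the products of the `y i`, the mixed products
`y i * y j * z k` with `i ≠ j`, and `z 0 * z 1 * z 2`. -/
theorem mul_mul_mem_of_sq_mul_mem (hyyy : ∀ i j k, y i * y j * y k ∈ T)
    (hyyz : ∀ j k, y (j + 1) * y (j + 2) * z k ∈ T)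
    (hzzy : ∀ k j, z k ^ 2 * y j ∈ T) (hzzz : ∀ k j, z k ^ 2 * z j ∈ T)
    (hpy : ∀ i j, (y i + z (i + 1) + z (i + 2)) ^ 2 * y j ∈ T)
    (hpz : ∀ i j, (y i + z (i + 1) + z (i + 2)) ^ 2 * z j ∈ T)
    (hz : z 0 * z 1 * z 2 ∈ T) :
    (∀ i j k, y i * y j * z k ∈ T) ∧ (∀ i j k, y i * z j * z k ∈ T) ∧
      (∀ i j k, z i * z j * z k ∈ T) := by
  have hyz_ne : ∀ i j k, i ≠ j → y i * y j * z k ∈ T := by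
    intro i j k hij
    obtain ⟨l, hl⟩ : ∃ l, i = l + 1 ∧ j = l + 2 ∨ j = l + 1 ∧ i = l + 2 := by decide +revert
    rcases hl with ⟨rfl, rfl⟩ | ⟨rfl, rfl⟩
    · exact hyyz l k
    · rw [mul_comm (y _)]
      exact hyyz l k
  have hzz_ne : ∀ i j, j ≠ i → y j * z (i + 1) * z (i + 2) ∈ T := by
    intro i j hij
    refine T.mem_of_natCast_mul_mem 2 ?_
    convert T.sub_mem (hpy i j) (T.add_mem (T.add_mem (hyyy i i j)
      (T.smul_mem 2 (T.add_mem (hyz_ne i j (i + 1) hij.symm) (hyz_ne i j (i + 2) hij.symm))))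
      (T.add_mem (hzzy (i + 1) j) (hzzy (i + 2) j))) using 1
    simp only [ofNat_smul_eq_nsmul, nsmul_eq_mul]
    push_cast
    ring
  have hyyz_one : ∀ i, y i * y i * z (i + 1) + 2 * (y i * z (i + 1) * z (i + 2)) ∈ T := by
    intro i
    convert T.sub_mem (hpz i (i + 1)) (T.add_mem (T.add_mem (hzzz (i + 1) (i + 1))
      (hzzz (i + 2) (i + 1))) (T.smul_mem 2 (T.add_mem (hzzy (i + 1) i)
      (hzzz (i + 1) (i + 2))))) using 1
    simp only [ofNat_smul_eq_nsmul, nsmul_eq_mul]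
    push_cast
    ring
  have hyyz_two : ∀ i, y i * y i * z (i + 2) + 2 * (y i * z (i + 1) * z (i + 2)) ∈ T := by
    intro i
    convert T.sub_mem (hpz i (i + 2)) (T.add_mem (T.add_mem (hzzz (i + 2) (i + 2))
      (hzzz (i + 1) (i + 2))) (T.smul_mem 2 (T.add_mem (hzzy (i + 2) i)
      (hzzz (i + 2) (i + 1))))) using 1
    simp only [ofNat_smul_eq_nsmul, nsmul_eq_mul]
    push_cast
    ring
  have hzz_eq : ∀ i, y i * z (i + 1) * z (i + 2) ∈ T := by
    intro i
    refine T.mem_of_natCast_mul_mem 6 ?_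
    convert T.sub_mem (T.smul_mem 2 (T.add_mem (hyyz_one i) (hyyz_two i)))
      (T.sub_mem (hpy i i) (T.add_mem (hyyy i i i)
      (T.add_mem (hzzy (i + 1) i) (hzzy (i + 2) i)))) using 1
    simp only [ofNat_smul_eq_nsmul, nsmul_eq_mul]
    push_cast
    ring
  have hyzz : ∀ i j k, y i * z j * z k ∈ T := by
    intro i j k
    by_cases hjk : j = k
    · subst hjk
      convert hzzy j i using 1
      ring
    have hmem : ∀ l, y i * z (l + 1) * z (l + 2) ∈ T := by
      intro l
      by_cases hil : i = l
      · exact hil ▸ hzz_eq i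
      · exact hzz_ne l i hil
    obtain ⟨l, hl⟩ : ∃ l, j = l + 1 ∧ k = l + 2 ∨ k = l + 1 ∧ j = l + 2 := by decide +revert
    rcases hl with ⟨rfl, rfl⟩ | ⟨rfl, rfl⟩
    · exact hmem l
    · rw [mul_right_comm]
      exact hmem l
  have hzzz' : ∀ i j k, z i * z j * z k ∈ T := by
    intro i j k
    by_cases hij : i = j
    · subst hij
      simpa [sq] using hzzz i k
    by_cases hik : i = k
    · subst hik
      simpa [sq, mul_right_comm] using hzzz i j
    by_cases hjk : j = k
    · subst hjk
      simpa [sq, mul_comm, mul_left_comm] using hzzz j i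
    convert hz using 1
    fin_cases i <;> fin_cases j <;> fin_cases k <;> simp at hij hik hjk ⊢ <;> ring
  refine ⟨fun i j k => ?_, hyzz, hzzz'⟩
  by_cases hij : i = j
  · subst hij
    obtain hk : k = i + 1 ∨ k = i + 2 ∨ k = i := by decide +revert
    have htwo : 2 * (y i * z (i + 1) * z (i + 2)) ∈ T := by
      rw [two_mul]
      exact T.add_mem (hzz_eq i) (hzz_eq i)
    rcases hk with rfl | rfl | rfl
    · exact (T.add_mem_iff_left htwo).mp (hyyz_one i)
    · exact (T.add_mem_iff_left htwo).mp (hyyz_two i)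
    · convert T.sub_mem (hpz k k) (T.add_mem (T.smul_mem 2 (T.add_mem (T.add_mem
        (hyzz k (k + 1) k) (hyzz k (k + 2) k)) (hzzz' k (k + 1) (k + 2))))
        (T.add_mem (hzzz (k + 1) k) (hzzz (k + 2) k))) using 1
      simp only [ofNat_smul_eq_nsmul, nsmul_eq_mul]
      push_cast
      ring
  · exact hyz_ne i j k hij

end Spanning

theorem hasDerivAt_map_linForm_pow_three {M : Type*} [NormedAddCommGroup M] [NormedSpace ℂ M]
    {n : ℕ} (E : MvPolynomial (Fin n) ℂ →ₗ[ℂ] M) {u : ℂ → Fin n → ℂ} {u' : Fin n → ℂ} {s : ℂ}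
    (hu : HasDerivAt u u' s) :
    HasDerivAt (fun s => E (linForm (u s) ^ 3)) (E (3 * linForm (u s) ^ 2 * linForm u')) s := by
  have hu' := hasDerivAt_pi.mp hu
  have h3 : E (3 * linForm (u s) ^ 2 * linForm u') =
      E (linForm u' * linForm (u s) * linForm (u s)) +
        E (linForm (u s) * linForm u' * linForm (u s)) +
        E (linForm (u s) * linForm (u s) * linForm u') := by
    rw [← map_add, ← map_add]
    congr 1
    ring
  rw [h3]
  simp only [pow_three', map_linForm_mul, ← Finset.sum_add_distrib, ← add_smul]
  refine HasDerivAt.fun_sum fun i _ => HasDerivAt.fun_sum fun j _ =>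
    HasDerivAt.fun_sum fun k _ => ?_
  convert (((hu' i).fun_mul (hu' j)).fun_mul (hu' k)).smul_const (E (X i * X j * X k)) using 2
  ring

/-- The derivative of `coplanarCubic` at `p` in the direction `v`. -/
noncomputable def coplanarTangent (p v : CoplanarParam) : MvPolynomial (Fin 6) ℂ :=
  ∑ i, 3 * linForm (∑ j, p.2.1 i j • p.1 j) ^ 2 *
      linForm (∑ j, (p.2.1 i j • v.1 j + v.2.1 i j • p.1 j)) +
    ∑ k, 3 * linForm (p.2.2 k) ^ 2 * linForm (v.2.2 k)

theorem fderiv_coplanarCubic (E : MvPolynomial (Fin 6) ℂ →ₗ[ℂ] (Fin 56 → ℂ))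
    (p v : CoplanarParam) :
    fderiv ℂ (fun p => E (coplanarCubic p)) p v = E (coplanarTangent p v) := by
  have hline : HasDerivAt (fun s : ℂ => p + s • v) v 0 := by
    simpa using ((hasDerivAt_id (0 : ℂ)).smul_const v).const_add p
  have hb (j : Fin 3) : HasDerivAt (fun s : ℂ => (p + s • v).1 j) (v.1 j) 0 := by
    simpa using ((hasDerivAt_id (0 : ℂ)).smul_const (v.1 j)).const_add (p.1 j)
  have hc (i : Fin 4) (j : Fin 3) :
      HasDerivAt (fun s : ℂ => (p + s • v).2.1 i j) (v.2.1 i j) 0 := by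
    simpa using ((hasDerivAt_id (0 : ℂ)).smul_const (v.2.1 i j)).const_add (p.2.1 i j)
  have ha (k : Fin 6) : HasDerivAt (fun s : ℂ => (p + s • v).2.2 k) (v.2.2 k) 0 := by
    simpa using ((hasDerivAt_id (0 : ℂ)).smul_const (v.2.2 k)).const_add (p.2.2 k)
  have hd :
      HasDerivAt (fun s : ℂ => E (coplanarCubic (p + s • v))) (E (coplanarTangent p v)) 0 := by
    simp only [coplanarCubic, coplanarTangent, map_add E, map_sum E]
    refine HasDerivAt.add (HasDerivAt.fun_sum fun i _ => ?_) (HasDerivAt.fun_sum fun k _ => ?_)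
    · have h := hasDerivAt_map_linForm_pow_three E
        (HasDerivAt.fun_sum fun j (_ : j ∈ Finset.univ) => (hc i j).fun_smul (hb j))
      simpa using h
    · simpa using hasDerivAt_map_linForm_pow_three E (ha k)
  have hp : HasFDerivAt (fun p => E (coplanarCubic p))
      (fderiv ℂ (fun p => E (coplanarCubic p)) p) (p + (0 : ℂ) • v) := by
    rw [zero_smul, add_zero]
    exact ((contDiff_coplanarCubic E 1).differentiable one_ne_zero p).hasFDerivAt
  have hcomp := hp.comp_hasDerivAt (0 : ℂ) hline
  exact hcomp.unique hd

theorem homogeneousSubmodule_three_le {n : ℕ} {T : Submodule ℂ (MvPolynomial (Fin n) ℂ)}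
    (hT : ∀ i j k, X i * X j * X k ∈ T) : homogeneousSubmodule (Fin n) ℂ 3 ≤ T := by
  rw [← homogeneousSubmodule_one_pow, homogeneousSubmodule_one_eq_span_X, pow_three',
    Submodule.span_mul_span, Submodule.span_mul_span, Submodule.span_le]
  rintro _ ⟨_, ⟨_, ⟨i, rfl⟩, _, ⟨j, rfl⟩, rfl⟩, _, ⟨k, rfl⟩, rfl⟩
  exact hT i j k

/-- The coordinate vectors spanning the plane of the base point. -/
def planeVec (j : Fin 3) : Fin 6 → ℂ := Pi.single (Fin.castAdd 3 j) 1

/-- The coordinate vectors complementary to the plane of the base point. -/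
def normalVec (k : Fin 3) : Fin 6 → ℂ := Pi.single (Fin.natAdd 3 k) 1

/-- A point at which `coplanarCubic` has a derivative of corank one. -/
def basePoint : CoplanarParam :=
  (planeVec, tetrahedron, Fin.append (m := 3) (n := 3) normalVec
    fun i => planeVec i + normalVec (i + 1) + normalVec (i + 2))

theorem linForm_planeVec (j : Fin 3) : linForm (planeVec j) = X (Fin.castAdd 3 j) :=
  linForm_single _

theorem linForm_normalVec (k : Fin 3) : linForm (normalVec k) = X (Fin.natAdd 3 k) :=
  linForm_single _

theorem linForm_zero {n : ℕ} : linForm (0 : Fin n → ℂ) = 0 := by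
  simp [linForm]

theorem linForm_basePoint_plane (i : Fin 4) :
    linForm (∑ l, basePoint.2.1 i l • basePoint.1 l) =
      ∑ l, tetrahedron i l • X (Fin.castAdd 3 l) := by
  simp only [linForm_sum, linForm_smul, basePoint, linForm_planeVec]

theorem coplanarTangent_basePoint_plane (j k : Fin 3) :
    coplanarTangent basePoint (Pi.single j (normalVec k), 0, 0) =
      3 * ∑ i, tetrahedron i j •
        ((∑ l, tetrahedron i l • X (Fin.castAdd 3 l)) ^ 2 * X (Fin.natAdd 3 k)) := by
  have hsum (i : Fin 4) : ∑ l, (basePoint.2.1 i l • (Pi.single j (normalVec k) : Fin 3 → _) l +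
      (0 : Fin 4 → Fin 3 → ℂ) i l • basePoint.1 l) = tetrahedron i j • normalVec k := by
    rw [Finset.sum_eq_single j (fun l _ hl => by simp [hl]) (by simp)]
    simp [basePoint]
  simp only [coplanarTangent, linForm_basePoint_plane, hsum]
  simp only [linForm_smul, linForm_normalVec, Pi.zero_apply, linForm_zero, mul_zero,
    Finset.sum_const_zero, add_zero, Finset.mul_sum, mul_smul_comm, mul_assoc]

theorem coplanarTangent_basePoint_coord (i : Fin 4) (j : Fin 3) :
    coplanarTangent basePoint (0, Pi.single i (Pi.single j 1), 0) =
      3 * ((∑ l, tetrahedron i l • X (Fin.castAdd 3 l)) ^ 2 * X (Fin.castAdd 3 j)) := by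
  have hsum (m : Fin 4) : ∑ l, (basePoint.2.1 m l • (0 : Fin 3 → Fin 6 → ℂ) l +
      (Pi.single i (Pi.single j 1) : Fin 4 → Fin 3 → ℂ) m l • basePoint.1 l) =
        if m = i then planeVec j else 0 := by
    split_ifs with hm
    · subst hm
      rw [Finset.sum_eq_single j (fun l _ hl => by simp [hl]) (by simp)]
      simp [basePoint]
    · simp [hm]
  simp only [coplanarTangent, linForm_basePoint_plane, hsum]
  simp only [apply_ite linForm, linForm_planeVec, Pi.zero_apply, linForm_zero, mul_zero,
    Finset.sum_const_zero, add_zero, mul_ite, Finset.sum_ite_eq', Finset.mem_univ, if_true,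
    mul_assoc]

theorem coplanarTangent_basePoint_free (k l : Fin 6) :
    coplanarTangent basePoint (0, 0, Pi.single k (Pi.single l 1)) =
      3 * (linForm (basePoint.2.2 k) ^ 2 * X l) := by
  have hsum (i : Fin 4) : ∑ j, (basePoint.2.1 i j • (0 : Fin 3 → Fin 6 → ℂ) j +
      (0 : Fin 4 → Fin 3 → ℂ) i j • basePoint.1 j) = 0 := by
    simp
  simp only [coplanarTangent, hsum, linForm_zero, mul_zero, Finset.sum_const_zero, zero_add]
  rw [Finset.sum_eq_single k (fun m _ hm => by simp [hm, linForm_zero]) (by simp)]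
  simp [linForm_single, mul_assoc]

theorem homogeneousSubmodule_le_of_coplanarTangent_mem
    {T : Submodule ℂ (MvPolynomial (Fin 6) ℂ)} (hT : ∀ v, coplanarTangent basePoint v ∈ T)
    (hz : X 3 * X 4 * X 5 ∈ T) : homogeneousSubmodule (Fin 6) ℂ 3 ≤ T := by
  have h3 {f : MvPolynomial (Fin 6) ℂ} (h : 3 * f ∈ T) : f ∈ T :=
    T.mem_of_natCast_mul_mem 3 (by exact_mod_cast h)
  let y : Fin 3 → MvPolynomial (Fin 6) ℂ := fun j => X (Fin.castAdd 3 j)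
  let z : Fin 3 → MvPolynomial (Fin 6) ℂ := fun k => X (Fin.natAdd 3 k)
  have hyyy : ∀ i j k, y i * y j * y k ∈ T := mul_mem_of_tetrahedron_sq_mul_mem fun i j =>
    h3 (coplanarTangent_basePoint_coord i j ▸ hT _)
  have hyyz : ∀ j k, y (j + 1) * y (j + 2) * z k ∈ T := fun j k =>
    mul_mul_mem_of_sum_tetrahedron_mem (h3 (coplanarTangent_basePoint_plane j k ▸ hT _))
  have hfree (k l : Fin 6) : linForm (basePoint.2.2 k) ^ 2 * X l ∈ T :=
    h3 (coplanarTangent_basePoint_free k l ▸ hT _)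
  have hnormal (k : Fin 3) : linForm (basePoint.2.2 (Fin.castAdd 3 k)) = z k := by
    have h : basePoint.2.2 (Fin.castAdd 3 k) = normalVec k :=
      Fin.append_left (m := 3) (n := 3) normalVec
        (fun i => planeVec i + normalVec (i + 1) + normalVec (i + 2)) k
    rw [h, linForm_normalVec]
  have hmixed (i : Fin 3) :
      linForm (basePoint.2.2 (Fin.natAdd 3 i)) = y i + z (i + 1) + z (i + 2) := by
    have h : basePoint.2.2 (Fin.natAdd 3 i) =
        planeVec i + normalVec (i + 1) + normalVec (i + 2) :=
      Fin.append_right (m := 3) (n := 3) normalVec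
        (fun i => planeVec i + normalVec (i + 1) + normalVec (i + 2)) i
    rw [h, linForm_add, linForm_add, linForm_planeVec, linForm_normalVec, linForm_normalVec]
  obtain ⟨hyyz, hyzz, hzzz⟩ := mul_mul_mem_of_sq_mul_mem hyyy hyyz
    (fun k j => hnormal k ▸ hfree _ _) (fun k j => hnormal k ▸ hfree _ _)
    (fun i j => hmixed i ▸ hfree _ _) (fun i j => hmixed i ▸ hfree _ _) hz
  refine homogeneousSubmodule_three_le fun i j k => ?_
  refine Fin.addCases (m := 3) (n := 3) (fun i => ?_) (fun i => ?_) i <;>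
  refine Fin.addCases (m := 3) (n := 3) (fun j => ?_) (fun j => ?_) j <;>
  refine Fin.addCases (m := 3) (n := 3) (fun k => ?_) (fun k => ?_) k
  · exact hyyy i j k
  · exact hyyz i j k
  · convert hyyz i k j using 1
    ring
  · exact hyzz i j k
  · convert hyyz j k i using 1
    ring
  · convert hyzz j i k using 1
    ring
  · convert hyzz k i j using 1
    ring
  · exact hzzz i j k

/-- No nonzero polynomial vanishes on the translates of the coplanar sums of cubes along the
monomial `x₃ x₄ x₅`, because these translates contain an open set. -/
theorem eq_zero_of_eval_translates_eq_zero {E : MvPolynomial (Fin 6) ℂ →ₗ[ℂ] (Fin 56 → ℂ)}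
    (hE : (homogeneousSubmodule (Fin 6) ℂ 3).map E = ⊤) {P : MvPolynomial (Fin 56) ℂ}
    (hP : ∀ p : CoplanarParam, ∀ s : ℂ,
      eval (E (coplanarCubic p) + s • E (X 3 * X 4 * X 5)) P = 0) : P = 0 := by
  let Θ : CoplanarParam × ℂ → Fin 56 → ℂ := fun q =>
    E (coplanarCubic q.1) + q.2 • E (X 3 * X 4 * X 5)
  let D : CoplanarParam × ℂ →L[ℂ] Fin 56 → ℂ :=
    (fderiv ℂ (fun p => E (coplanarCubic p)) basePoint).comp (ContinuousLinearMap.fst ℂ _ _) +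
      (ContinuousLinearMap.snd ℂ _ _).smulRight (E (X 3 * X 4 * X 5))
  have hΘ : HasStrictFDerivAt Θ D (basePoint, 0) := by
    have h := (contDiff_coplanarCubic E 1).contDiffAt.hasStrictFDerivAt one_ne_zero
      (x := basePoint)
    have hsnd : HasStrictFDerivAt (fun q : CoplanarParam × ℂ => q.2)
        (ContinuousLinearMap.snd ℂ CoplanarParam ℂ) (basePoint, 0) := hasStrictFDerivAt_snd
    exact (h.comp (basePoint, (0 : ℂ)) hasStrictFDerivAt_fst).add (hsnd.smul_const _)
  have hD : D.range = ⊤ := by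
    rw [eq_top_iff, ← hE, Submodule.map_le_iff_le_comap]
    refine homogeneousSubmodule_le_of_coplanarTangent_mem (fun v => ⟨(v, 0), ?_⟩) ⟨(0, 1), ?_⟩
    · simp [D, fderiv_coplanarCubic]
    · simp [D]
  have hnhds : Set.range Θ ∈ nhds (Θ (basePoint, 0)) := by
    rw [← hΘ.map_nhds_eq_of_surj hD]
    exact Filter.range_mem_map
  obtain ⟨ε, hε, hball⟩ := Metric.mem_nhds_iff.mp hnhds
  refine MvPolynomial.funext_set (fun i => Metric.ball (Θ (basePoint, 0) i) ε)
    (fun i => infinite_of_mem_nhds _ (Metric.ball_mem_nhds _ hε)) fun x hx => ?_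
  rw [← ball_pi _ hε] at hx
  obtain ⟨⟨p, s⟩, rfl⟩ := hball hx
  rw [map_zero]
  exact hP p s

/-- The sorted triples of indices, one for each cubic monomial in three variables. -/
abbrev SortedTriple : Type :=
  {m : Fin 3 × Fin 3 × Fin 3 // m.1 ≤ m.2.1 ∧ m.2.1 ≤ m.2.2}

/-- The indices of the `55` parameters of `normalCubic`. -/
abbrev NormalIndex : Type := (Fin 3 × Fin 3) ⊕ SortedTriple ⊕ (Fin 6 × Fin 6)

/-- The vectors `e_j + ∑ k, M j k e_{3 + k}` spanning a general plane. -/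
def graphVec (M : Fin 3 → Fin 3 → ℂ) (j : Fin 3) : Fin 6 → ℂ :=
  Fin.append (m := 3) (n := 3) (Pi.single j 1) (M j)

/-- A cubic form on a general three-dimensional quotient space, plus six cubes. -/
noncomputable def normalCubic (t : NormalIndex → ℂ) : MvPolynomial (Fin 6) ℂ :=
  let b := graphVec fun j k => t (.inl (j, k))
  ∑ m : SortedTriple, t (.inr (.inl m)) •
      (linForm (b m.1.1) * linForm (b m.1.2.1) * linForm (b m.1.2.2)) +
    ∑ k, linForm (fun l => t (.inr (.inr (k, l)))) ^ 3

/-- A polynomial map from an affine space of smaller dimension satisfies a nontrivial algebraic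
relation. -/
theorem exists_ne_zero_eval_eq_zero_of_card_lt {K σ τ : Type} [Field K] [Fintype σ] [Fintype τ]
    (h : Fintype.card τ < Fintype.card σ) (G : σ → MvPolynomial τ K) :
    ∃ P : MvPolynomial σ K, P ≠ 0 ∧ ∀ t, eval (fun i => eval t (G i)) P = 0 := by
  have hG : ¬ Function.Injective (aeval G : MvPolynomial σ K →ₐ[K] MvPolynomial τ K) := by
    intro hinj
    have hle := trdeg_le_of_injective _ hinj
    rw [MvPolynomial.trdeg_of_isDomain, MvPolynomial.trdeg_of_isDomain] at hle
    simp only [Cardinal.mk_fintype, Cardinal.lift_natCast, Nat.cast_le] at hle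
    omega
  rw [injective_iff_map_eq_zero] at hG
  push Not at hG
  obtain ⟨P, hP, hP0⟩ := hG
  refine ⟨P, hP0, fun t => ?_⟩
  have h0 := congrArg (aeval t) hP
  rw [map_zero, comp_aeval_apply] at h0
  simpa [aeval_eq_eval] using h0

theorem exists_mvPolynomial_eval_normalCubic (E : MvPolynomial (Fin 6) ℂ →ₗ[ℂ] (Fin 56 → ℂ)) :
    ∃ G : Fin 56 → MvPolynomial NormalIndex ℂ,
      ∀ t, E (normalCubic t) = fun i => eval t (G i) := by
  let A : Subalgebra ℂ ((NormalIndex → ℂ) → ℂ) :=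
    (aeval fun i t => t i : MvPolynomial NormalIndex ℂ →ₐ[ℂ] ((NormalIndex → ℂ) → ℂ)).range
  have hX (i : NormalIndex) : (fun t => t i) ∈ A := ⟨X i, by simp⟩
  have hcomp {u v w : (NormalIndex → ℂ) → Fin 6 → ℂ} (hu : ∀ i, (fun t => u t i) ∈ A)
      (hv : ∀ i, (fun t => v t i) ∈ A) (hw : ∀ i, (fun t => w t i) ∈ A) (i : Fin 56) :
      (fun t => E (linForm (u t) * linForm (v t) * linForm (w t)) i) ∈ A := by
    have : (fun t => E (linForm (u t) * linForm (v t) * linForm (w t)) i) =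
        ∑ j, ∑ k, ∑ l, E (X j * X k * X l) i •
          ((fun t => u t j) * (fun t => v t k) * fun t => w t l) := by
      ext t
      simp [map_linForm_mul, mul_comm (E _ i)]
    rw [this]
    exact A.sum_mem fun j _ => A.sum_mem fun k _ => A.sum_mem fun l _ =>
      A.smul_mem (A.mul_mem (A.mul_mem (hu j) (hv k)) (hw l)) _
  have hb (j : Fin 3) (i : Fin 6) :
      (fun t : NormalIndex → ℂ => graphVec (fun j k => t (.inl (j, k))) j i) ∈ A := by
    refine Fin.addCases (m := 3) (n := 3) (fun i => ?_) (fun i => ?_) i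
    · simp only [graphVec, Fin.append_left]
      exact A.algebraMap_mem _
    · simp only [graphVec, Fin.append_right]
      exact hX _
  have hmem (i : Fin 56) : (fun t => E (normalCubic t) i) ∈ A := by
    have : (fun t => E (normalCubic t) i) =
        ∑ m : SortedTriple, (fun t : NormalIndex → ℂ => t (.inr (.inl m))) *
          (fun t => E (linForm (graphVec (fun j k => t (.inl (j, k))) m.1.1) *
            linForm (graphVec (fun j k => t (.inl (j, k))) m.1.2.1) *
            linForm (graphVec (fun j k => t (.inl (j, k))) m.1.2.2)) i) +
        ∑ k, fun t : NormalIndex → ℂ => E (linForm (fun l => t (.inr (.inr (k, l)))) *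
          linForm (fun l => t (.inr (.inr (k, l)))) *
          linForm (fun l => t (.inr (.inr (k, l))))) i := by
      ext t
      simp [normalCubic, pow_three']
    rw [this]
    exact A.add_mem (A.sum_mem fun m _ => A.mul_mem (hX _) (hcomp (hb _) (hb _) (hb _) i))
      (A.sum_mem fun k _ => hcomp (fun _ => hX _) (fun _ => hX _) (fun _ => hX _) i)
  choose G hG using hmem
  refine ⟨G, fun t => funext fun i => ?_⟩
  have h : aeval (fun i (t : NormalIndex → ℂ) => t i) (G i) t = E (normalCubic t) i :=
    congrFun (hG i) t
  rw [← h]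
  exact comp_aeval_apply _ (Pi.evalAlgHom ℂ (fun _ : NormalIndex → ℂ => ℂ) t) (G i)

theorem mul_mul_mem_span_sortedTriple {R : Type*} [CommRing R] [Algebra ℂ R] (y : Fin 3 → R)
    (i j k : Fin 3) :
    y i * y j * y k ∈ Submodule.span ℂ
      (Set.range fun m : SortedTriple => y m.1.1 * y m.1.2.1 * y m.1.2.2) := by
  have h : ∀ i j k : Fin 3, ∃ m : SortedTriple,
      ({m.1.1, m.1.2.1, m.1.2.2} : Multiset (Fin 3)) = {i, j, k} := by decide
  obtain ⟨m, hm⟩ := h i j k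
  refine Submodule.subset_span ⟨m, ?_⟩
  have := congrArg (fun s => (Multiset.map y s).prod) hm
  simpa [mul_assoc] using this

theorem mem_range_normalCubic {p : CoplanarParam}
    (hp : (Matrix.of fun i j => p.1 i (Fin.castAdd 3 j)).det ≠ 0) :
    coplanarCubic p ∈ Set.range normalCubic := by
  obtain ⟨b, c, a⟩ := p
  let B : Matrix (Fin 3) (Fin 3) ℂ := Matrix.of fun i j => b i (Fin.castAdd 3 j)
  let N : Matrix (Fin 3) (Fin 3) ℂ := Matrix.of fun i j => b i (Fin.natAdd 3 j)
  have hB : IsUnit B.det := isUnit_iff_ne_zero.mpr hp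
  let M : Matrix (Fin 3) (Fin 3) ℂ := B⁻¹ * N
  have hb (i : Fin 3) : b i = ∑ j, B i j • graphVec M j := by
    ext l
    refine Fin.addCases (m := 3) (n := 3) (fun l => ?_) (fun l => ?_) l
    · simp [graphVec, B, Pi.single_apply]
    · have h : (B * M) i l = N i l := by rw [Matrix.mul_nonsing_inv_cancel_left _ _ hB]
      rw [Matrix.mul_apply] at h
      simp only [Finset.sum_apply, Pi.smul_apply, smul_eq_mul, graphVec, Fin.append_right]
      exact h.symm
  let y : Fin 3 → MvPolynomial (Fin 6) ℂ := fun j => linForm (graphVec M j)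
  have hcube : ∑ i, linForm (∑ j, c i j • b j) ^ 3 ∈ Submodule.span ℂ
      (Set.range fun m : SortedTriple => y m.1.1 * y m.1.2.1 * y m.1.2.2) := by
    refine Submodule.sum_mem _ fun i _ => ?_
    have : linForm (∑ j, c i j • b j) = ∑ l, (∑ j, c i j * B j l) • y l := by
      simp only [hb, linForm_sum, linForm_smul, Finset.smul_sum, smul_smul, Finset.sum_smul, y]
      exact Finset.sum_comm
    rw [this, pow_three']
    simp only [Finset.sum_mul, Finset.mul_sum, smul_mul_smul_comm]
    exact Submodule.sum_mem _ fun j _ => Submodule.sum_mem _ fun k _ =>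
      Submodule.sum_mem _ fun l _ =>
        Submodule.smul_mem _ _ (mul_mul_mem_span_sortedTriple y _ _ _)
  obtain ⟨g, hg⟩ := (Submodule.mem_span_range_iff_exists_fun ℂ).mp hcube
  refine ⟨Sum.elim (fun jk => M jk.1 jk.2) (Sum.elim g fun kl => a kl.1 kl.2), ?_⟩
  simp only [normalCubic, Sum.elim_inl, Sum.elim_inr, coplanarCubic, ← hg]
  rfl

theorem exists_ne_zero_mem_vanishingIdealOf_range
    (E : MvPolynomial (Fin 6) ℂ →ₗ[ℂ] (Fin 56 → ℂ)) :
    ∃ P ≠ 0, P ∈ vanishingIdealOf (Set.range fun p => E (coplanarCubic p)) := by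
  obtain ⟨G, hG⟩ := exists_mvPolynomial_eval_normalCubic E
  obtain ⟨P, hP0, hP⟩ := exists_ne_zero_eval_eq_zero_of_card_lt (by decide) G
  refine ⟨P, hP0, mem_vanishingIdealOf.mpr ?_⟩
  rintro _ ⟨⟨b, c, a⟩, rfl⟩
  let γ : ℂ → CoplanarParam := fun s => (fun j => b j + s • planeVec j, c, a)
  let F : ℂ → ℂ := fun s => eval (E (coplanarCubic (γ s))) P
  have hF : Continuous F := by
    have h : Continuous fun s => E (coplanarCubic (γ s)) :=
      (contDiff_coplanarCubic E 0).continuous.comp (by fun_prop)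
    exact (MvPolynomial.continuous_eval P).comp h
  let B : Matrix (Fin 3) (Fin 3) ℂ := Matrix.of fun i j => b i (Fin.castAdd 3 j)
  have hdet (s : ℂ) (hs : ¬ (-B).charpoly.IsRoot s) : F s = 0 := by
    obtain ⟨t, ht⟩ := mem_range_normalCubic (p := γ s) (by
      convert hs using 1
      rw [Polynomial.IsRoot, Matrix.eval_charpoly]
      congr! 2
      ext i j
      simp [γ, B, planeVec, Matrix.scalar_apply, Matrix.diagonal_apply, Pi.single_apply,
        Fin.ext_iff, eq_comm, add_comm])
    simp only [F, ← ht, hG, hP]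
  have hdense : Dense {s : ℂ | ¬ (-B).charpoly.IsRoot s} :=
    (Polynomial.finite_setOfPred_isRoot (Matrix.charpoly_monic _).ne_zero).countable.dense_compl ℂ
  have h0 : F = fun _ => 0 := hF.ext_on hdense continuous_const hdet
  simpa [F, γ] using congrFun h0 0

/-- **Lemma 2.3.** The cubic forms which are sums of ten cubes of linear forms four of
which are coplanar have as Zariski closure an irreducible hypersurface in the
56-dimensional space of cubic forms: the vanishing ideal is prime of height 1. -/
theorem statement6 :
    ∀ e : (homogeneousSubmodule (Fin 6) ℂ 3) ≃ₗ[ℂ] (Fin 56 → ℂ),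
      IsHeightOnePrime (vanishingIdealOf (e ''
        {f : homogeneousSubmodule (Fin 6) ℂ 3 |
          ∃ a : Fin 10 → (Fin 6 → ℂ),
            (f : MvPolynomial (Fin 6) ℂ) = ∑ i, linForm (a i) ^ 3 ∧
            Module.finrank ℂ
              (Submodule.span ℂ ({a 0, a 1, a 2, a 3} : Set (Fin 6 → ℂ))) ≤ 3})) := by
  intro e
  obtain ⟨E, hE⟩ := e.toLinearMap.exists_extend
  have hEe (f : homogeneousSubmodule (Fin 6) ℂ 3) : E f = e f := LinearMap.congr_fun hE f
  have himage : e '' {f : homogeneousSubmodule (Fin 6) ℂ 3 |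
      ∃ a : Fin 10 → (Fin 6 → ℂ),
        (f : MvPolynomial (Fin 6) ℂ) = ∑ i, linForm (a i) ^ 3 ∧
        Module.finrank ℂ
          (Submodule.span ℂ ({a 0, a 1, a 2, a 3} : Set (Fin 6 → ℂ))) ≤ 3} =
      Set.range fun p => E (coplanarCubic p) := by
    ext x
    constructor
    · rintro ⟨f, hf, rfl⟩
      obtain ⟨p, hp⟩ := setOf_coplanar_eq_range.subset hf
      exact ⟨p, by rw [← hEe, ← hp]⟩
    · rintro ⟨p, rfl⟩
      exact ⟨⟨coplanarCubic p, coplanarCubic_isHomogeneous p⟩,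
        setOf_coplanar_eq_range.superset ⟨p, rfl⟩, (hEe _).symm⟩
  have hsurj : (homogeneousSubmodule (Fin 6) ℂ 3).map E = ⊤ :=
    eq_top_iff.mpr fun x _ => ⟨e.symm x, (e.symm x).2, by simp [hEe]⟩
  have hprime := isPrime_vanishingIdealOf_range E
  rw [himage]
  refine ⟨hprime, ⟨⊥, Ideal.isPrime_bot, bot_lt_iff_ne_bot.mpr ?_⟩, fun p q _ hq hpq =>
    not_lt_vanishingIdealOf_of_lt (m := E (X 3 * X 4 * X 5)) (fun P hP => ?_) hprime hpq⟩
  · obtain ⟨P, hP0, hP⟩ := exists_ne_zero_mem_vanishingIdealOf_range E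
    exact (Submodule.ne_bot_iff _).mpr ⟨P, hP, hP0⟩
  · exact eq_zero_of_eval_translates_eq_zero hsurj fun p s => hP _ ⟨p, rfl⟩ s
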